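/- There is no deterministic anonymous strategyproof mechanism with bounded approximation ratio for 3-Facility Location with 4 agents on the real line. Concretely: for every ρ ≥ 1 there is no mechanism F mapping 4 agent locations to 3 facility locations that is anonymous, strategyproof, and achieves social cost at most ρ times optimal on every 4-agent instance. -/

import Mathlib

noncomputable section

/-- Cost of an agent at `a` under a triple of facilities: distance to the
nearest facility. -/
def fcost3 (a : ℝ) (y : Fin 3 → ℝ) : ℝ := ⨅ ℓ, |a - y ℓ|

/-- Social cost of a 4-agent instance under three facilities. -/
def scost3 (x : Fin 4 → ℝ) (y : Fin 3 → ℝ) : ℝ := ∑ i, fcost3 (x i) y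

/-- Optimal social cost over all triples of facility locations. -/
def optCost3 (x : Fin 4 → ℝ) : ℝ := ⨅ y : Fin 3 → ℝ, scost3 x y

/-- The situation of two agents reporting `a` and `b` while the other two agents are fixed far
away: `G a b` is the set of facilities, only one of which can be close to the pair when the two
agents are at distance less than `s`, and every agent is served within distance `K`. -/
structure IsPairMechanism (G : ℝ → ℝ → Set ℝ) (s K R : ℝ) : Prop where
  symm : ∀ a b, G a b = G b a
  report : ∀ a b, ∀ z ∈ G a b, z ∈ G z b
  truthful : ∀ a y, y ∈ G a y → ∀ b, ∃ z ∈ G a b, |z - b| ≤ |y - b|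
  unique : ∀ a b, |a| ≤ R → |b| ≤ R → |a - b| < s →
    ∀ z ∈ G a b, ∀ w ∈ G a b, |z| ≤ 3 * R → |w| ≤ 3 * R → z = w
  diag : ∀ a, a ∈ G a a
  near : ∀ a b, |a| ≤ R → |b| ≤ R → ∃ z ∈ G a b, |z - b| ≤ K

/-- An agent slightly to the right of `p` never gets her own facility next to an agent at `p`. -/
def IsLeftPoint (G : ℝ → ℝ → Set ℝ) (s p : ℝ) : Prop :=
  ∀ q, p < q → q < p + s → q ∉ G p q

namespace IsPairMechanism

variable {G : ℝ → ℝ → Set ℝ} {s K R : ℝ}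

lemma neg (h : IsPairMechanism G s K R) :
    IsPairMechanism (fun a b => {z | -z ∈ G (-a) (-b)}) s K R where
  symm a b := by simp only [h.symm (-a) (-b)]
  report a b z hz := h.report _ _ _ hz
  truthful a y hy b := by
    obtain ⟨z, hz, hzb⟩ := h.truthful (-a) (-y) hy (-b)
    refine ⟨-z, by simpa using hz, ?_⟩
    rw [← abs_neg, ← abs_neg (y - b)]
    convert hzb using 2 <;> ring
  unique a b ha hb hab z hz w hw hz' hw' := by
    refine neg_injective (h.unique (-a) (-b) (by simpa) (by simpa) ?_ _ hz _ hw
      (by simpa) (by simpa))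
    rwa [neg_sub_neg, abs_sub_comm]
  diag a := h.diag _
  near a b ha hb := by
    obtain ⟨z, hz, hzb⟩ := h.near (-a) (-b) (by simpa) (by simpa)
    refine ⟨-z, by simpa using hz, ?_⟩
    rw [← abs_neg]
    convert hzb using 2
    ring

lemma report_right (h : IsPairMechanism G s K R) {a b z : ℝ} (hz : z ∈ G a b) : z ∈ G a z := by
  rw [h.symm] at hz ⊢
  exact h.report _ _ _ hz

lemma exists_between (h : IsPairMechanism G s K R) {a b : ℝ} (ha : -R ≤ a) (hab : a ≤ b)
    (hb : b ≤ R) (hs : b - a < s) :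
    ∃ f ∈ G a b, a ≤ f ∧ f ≤ b ∧ ∀ z ∈ G a b, |z| ≤ 3 * R → z = f := by
  have ha' : |a| ≤ R := abs_le.2 ⟨ha, by linarith⟩
  have hb' : |b| ≤ R := abs_le.2 ⟨by linarith, hb⟩
  have hs' : |a - b| < s := by rw [abs_sub_comm, abs_of_nonneg (by linarith)]; exact hs
  obtain ⟨f, hf, hfb⟩ := h.truthful a a (h.diag a) b
  obtain ⟨g, hg, hga⟩ := h.truthful b b (h.diag b) a
  rw [h.symm] at hg
  rw [abs_sub_comm a b, abs_of_nonneg (by linarith : 0 ≤ b - a), abs_le] at hfb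
  rw [abs_of_nonneg (by linarith : 0 ≤ b - a), abs_le] at hga
  have hf3 : |f| ≤ 3 * R := abs_le.2 ⟨by linarith, by linarith⟩
  have hg3 : |g| ≤ 3 * R := abs_le.2 ⟨by linarith, by linarith⟩
  have hfg := h.unique a b ha' hb' hs' f hf g hg hf3 hg3
  exact ⟨f, hf, by linarith, by linarith, fun z hz hz3 => h.unique a b ha' hb' hs' z hz f hf hz3 hf3⟩

lemma no_hole (h : IsPairMechanism G s K R) {g b y : ℝ} (hg : -R ≤ g) (hb : b ≤ R)
    (hs : b - g < s) (hS : g ∈ G b g) (hgy : g ≤ y) (hyb : y ≤ b) : y ∈ G b y := by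
  set T : Set ℝ := {x | g ≤ x ∧ x ≤ y ∧ x ∈ G b x}
  have hgT : g ∈ T := ⟨le_rfl, hgy, hS⟩
  have hlub : IsLUB T (sSup T) := isLUB_csSup ⟨g, hgT⟩ ⟨y, fun x hx => hx.2.1⟩
  set l := sSup T
  have hgl : g ≤ l := hlub.1 hgT
  have hly : l ≤ y := hlub.2 fun x hx => hx.2.1
  have key : ∀ x ∈ T, ∀ a, g ≤ a → a ≤ b → x ≤ a →
      ∃ f, f ∈ G b f ∧ f ∈ G b a ∧ a ≤ f ∧ f ≤ 2 * a - x := by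
    intro x hx a hga hab hxa
    obtain ⟨f, hf, h1, h2, h3⟩ := h.exists_between (a := a) (b := b) (by linarith) hab hb
      (by linarith)
    obtain ⟨z, hz, hza⟩ := h.truthful b x hx.2.2 a
    rw [abs_sub_comm x a, abs_of_nonneg (by linarith : 0 ≤ a - x), abs_le] at hza
    rw [h.symm] at hz hf
    have := hx.1
    have hzf := h3 z hz (abs_le.2 ⟨by linarith, by linarith⟩)
    exact ⟨f, h.report_right hf, hf, h1, by linarith⟩
  have hlS : l ∈ G b l := by
    obtain ⟨f, hf, h1, h2, h3⟩ := h.exists_between (a := l) (b := b) (by linarith)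
      (by linarith) hb (by linarith)
    suffices f = l by rw [h.symm, ← this]; rw [this] at hf ⊢; exact hf
    refine le_antisymm (le_of_forall_pos_le_add fun ε hε => ?_) h1
    obtain ⟨x, hx, hxl, hxl'⟩ := hlub.exists_between (show l - ε < l by linarith)
    obtain ⟨f', hf', hf'', h4, h5⟩ := key x hx l hgl (by linarith) hxl'
    rw [h.symm] at hf''
    have := hx.1
    have := h3 f' hf'' (abs_le.2 ⟨by linarith, by linarith⟩)
    linarith
  rcases hly.eq_or_lt with e | hlt
  · rwa [← e]
  · obtain ⟨f, hf, -, h4, h5⟩ := key l ⟨hgl, hly, hlS⟩ ((l + y) / 2) (by linarith) (by linarith)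
      (by linarith)
    have := hlub.1 (show f ∈ T from ⟨by linarith, by linarith, hf⟩)
    linarith

lemma no_hole' (h : IsPairMechanism G s K R) {g b y : ℝ} (hb : -R ≤ b) (hg : g ≤ R)
    (hs : g - b < s) (hS : g ∈ G b g) (hby : b ≤ y) (hyg : y ≤ g) : y ∈ G b y := by
  have := h.neg.no_hole (g := -g) (b := -b) (y := -y) (by linarith) (by linarith) (by linarith)
    (by simpa using hS) (by linarith) (by linarith)
  simpa using this

lemma isLeftPoint_step (h : IsPairMechanism G s K R) {p p' : ℝ} (hp : -R ≤ p) (hpR : p' + s ≤ R)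
    (hpp : p < p') (hps : p' < p + s) (hL : IsLeftPoint G s p) : IsLeftPoint G s p' := by
  intro q hq hqs hS
  obtain ⟨r, hr1, hr2, hr3⟩ : ∃ r, p' < r ∧ r ≤ q ∧ r < p + s := by
    refine ⟨min q ((p' + p + s) / 2), lt_min hq (by linarith), min_le_left _ _, ?_⟩
    exact (min_le_right _ _).trans_lt (by linarith)
  have hrS := h.no_hole' (by linarith) (by linarith) (by linarith) hS hr1.le hr2
  obtain ⟨f, hf, h1, h2, -⟩ := h.exists_between (a := p) (b := r) hp (by linarith) (by linarith)
    (by linarith)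
  have hfp : f = p := by
    by_contra hne
    exact hL f (lt_of_le_of_ne h1 (Ne.symm hne)) (by linarith) (h.report_right hf)
  subst hfp
  rw [h.symm] at hf
  have hp'S := h.no_hole hp (by linarith) (by linarith) hf hpp.le hr1.le
  rw [h.symm] at hp'S
  have := h.unique p' r (abs_le.2 ⟨by linarith, by linarith⟩) (abs_le.2 ⟨by linarith, by linarith⟩)
    (abs_lt.2 ⟨by linarith, by linarith⟩) _ hp'S _ hrS (abs_le.2 ⟨by linarith, by linarith⟩)
    (abs_le.2 ⟨by linarith, by linarith⟩)
  linarith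

lemma isLeftPoint_of_le (h : IsPairMechanism G s K R) (hs : 0 < s) {p p' : ℝ} (hp : -R ≤ p)
    (hpp : p ≤ p') (hpR : p' + s ≤ R) (hL : IsLeftPoint G s p) : IsLeftPoint G s p' := by
  have key : ∀ n : ℕ, ∀ x, p ≤ x → x ≤ p + n * (s / 2) → x + s ≤ R → IsLeftPoint G s x := by
    intro n
    induction n with
    | zero =>
      intro x h1 h2 _
      have : x = p := le_antisymm (by simpa using h2) h1
      rwa [this]
    | succ n ih =>
      intro x h1 h2 h3
      push_cast at h2
      by_cases hx : x ≤ p + s / 2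
      · rcases h1.eq_or_lt with e | hlt
        · rwa [← e]
        · exact h.isLeftPoint_step hp h3 hlt (by linarith) hL
      · exact h.isLeftPoint_step (p := x - s / 2) (by linarith) h3 (by linarith) (by linarith)
          (ih _ (by linarith) (by linarith) (by linarith))
  obtain ⟨n, hn⟩ := exists_nat_ge ((p' - p) / (s / 2))
  rw [div_le_iff₀ (by linarith)] at hn
  exact key n p' hpp (by linarith) hpR

lemma not_isLeftPoint (h : IsPairMechanism G s K R) (hs : 0 < s) (hsK : s ≤ K)
    (hK : 10 * K ≤ R) {p : ℝ} (hp : |p| ≤ K) : ¬ IsLeftPoint G s p := by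
  intro hL
  rw [abs_le] at hp
  have key : ∀ n : ℕ, ∀ a y, p ≤ a → a < y → y ≤ p + 3 * K → y - a < s * (3 / 2) ^ n →
      y ∉ G a y := by
    intro n
    induction n with
    | zero =>
      intro a y h1 h2 h3 h4
      exact h.isLeftPoint_of_le hs (by linarith) h1 (by linarith) hL y h2
        (by linarith [pow_zero (3 / 2 : ℝ)])
    | succ n ih =>
      intro a y h1 h2 h3 h4 hS
      rw [pow_succ] at h4
      obtain ⟨z, hz, hzb⟩ := h.truthful a y hS (a + 2 / 3 * (y - a))
      rw [abs_of_nonneg (by linarith : 0 ≤ y - (a + 2 / 3 * (y - a))), abs_le] at hzb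
      rcases le_or_gt z (a + 2 / 3 * (y - a)) with hle | hgt
      · exact ih a z h1 (by linarith) (by linarith) (by linarith) (h.report_right hz)
      · rw [h.symm] at hz
        exact ih _ z (by linarith) hgt (by linarith) (by linarith) (h.report_right hz)
  obtain ⟨z, hz, hzb⟩ := h.near p (p + 2 * K) (abs_le.2 ⟨by linarith, by linarith⟩)
    (abs_le.2 ⟨by linarith, by linarith⟩)
  rw [abs_le] at hzb
  obtain ⟨n, hn⟩ := pow_unbounded_of_one_lt (3 * K / s) (by norm_num : (1 : ℝ) < 3 / 2)
  rw [div_lt_iff₀ hs] at hn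
  exact key n p z le_rfl (by linarith) (by linarith) (by linarith) (h.report_right hz)

lemma false (h : IsPairMechanism G s K R) (hs : 0 < s) (hsK : s ≤ K) (hK : 10 * K ≤ R) :
    False := by
  have hL := h.not_isLeftPoint hs hsK hK (p := 0) (by simp; linarith)
  simp only [IsLeftPoint, not_forall, not_not] at hL
  obtain ⟨q, hq, hqs, hS⟩ := hL
  refine h.neg.not_isLeftPoint hs hsK hK (p := -q) (by rw [abs_neg, abs_of_pos hq]; linarith) ?_
  intro r hr hrs hr'
  simp only [Set.mem_ofPred_eq, neg_neg] at hr'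
  have hbound : ∀ x, -R ≤ x → x ≤ R → |x| ≤ R := fun x h1 h2 => abs_le.2 ⟨h1, h2⟩
  have hbound' : ∀ x, -R ≤ x → x ≤ R → |x| ≤ 3 * R :=
    fun x h1 h2 => abs_le.2 ⟨by linarith, by linarith⟩
  have huniq : ∀ z ∈ G 0 q, |z| ≤ 3 * R → z = q := fun z hz hz3 =>
    h.unique 0 q (hbound _ (by linarith) (by linarith)) (hbound _ (by linarith) (by linarith))
      (abs_lt.2 ⟨by linarith, by linarith⟩) _ hz _ hS hz3 (hbound' _ (by linarith) (by linarith))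
  rcases le_or_gt (-r) 0 with hle | hgt
  · have h0 := h.no_hole (by linarith) (by linarith) (by linarith) hr' hle hq.le
    rw [h.symm] at h0
    linarith [huniq 0 h0 (hbound' _ (by linarith) (by linarith))]
  · obtain ⟨z, hz, hz0⟩ := h.truthful q (-r) hr' 0
    rw [sub_zero, sub_zero, abs_of_pos hgt] at hz0
    rw [h.symm] at hz
    have hzq := huniq z hz (by linarith)
    rw [hzq, abs_of_pos hq] at hz0
    linarith

end IsPairMechanism

lemma fcost3_le (a : ℝ) (y : Fin 3 → ℝ) (l : Fin 3) : fcost3 a y ≤ |a - y l| :=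
  ciInf_le ⟨0, by rintro _ ⟨l, rfl⟩; exact abs_nonneg _⟩ l

lemma exists_fcost3_eq (a : ℝ) (y : Fin 3 → ℝ) : ∃ l, |a - y l| = fcost3 a y :=
  exists_eq_ciInf_of_finite

lemma fcost3_nonneg (a : ℝ) (y : Fin 3 → ℝ) : 0 ≤ fcost3 a y :=
  le_ciInf fun _ => abs_nonneg _

lemma optCost3_le (x : Fin 4 → ℝ) (y : Fin 3 → ℝ) : optCost3 x ≤ scost3 x y :=
  ciInf_le ⟨0, by rintro _ ⟨y, rfl⟩; exact Finset.sum_nonneg fun _ _ => fcost3_nonneg _ _⟩ y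

lemma optCost3_le_left (a b c d : ℝ) : optCost3 ![a, b, c, d] ≤ |a - b| := by
  refine (optCost3_le _ ![b, c, d]).trans ?_
  have h0 := fcost3_le a ![b, c, d] 0
  have h1 := fcost3_le b ![b, c, d] 0
  have h2 := fcost3_le c ![b, c, d] 1
  have h3 := fcost3_le d ![b, c, d] 2
  simp at h0 h1 h2 h3
  simp [scost3, Fin.sum_univ_four]
  linarith

lemma optCost3_le_right (a b c d : ℝ) : optCost3 ![a, b, c, d] ≤ |c - d| := by
  refine (optCost3_le _ ![a, b, d]).trans ?_
  have h0 := fcost3_le a ![a, b, d] 0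
  have h1 := fcost3_le b ![a, b, d] 1
  have h2 := fcost3_le c ![a, b, d] 2
  have h3 := fcost3_le d ![a, b, d] 2
  simp at h0 h1 h2 h3
  simp [scost3, Fin.sum_univ_four]
  linarith

lemma isPairMechanism_of_nice {ρ : ℝ} (hρ : 1 ≤ ρ) {F : (Fin 4 → ℝ) → (Fin 3 → ℝ)}
    (hanon : ∀ (x : Fin 4 → ℝ) (π : Equiv.Perm (Fin 4)), F (x ∘ π) = F x)
    (hsp : ∀ (x : Fin 4 → ℝ) (i : Fin 4) (y : ℝ),
      fcost3 (x i) (F x) ≤ fcost3 (x i) (F (Function.update x i y)))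
    (happrox : ∀ x : Fin 4 → ℝ, scost3 x (F x) ≤ ρ * optCost3 x) :
    IsPairMechanism (fun a b => Set.range (F ![a, b, 100 * ρ, 100 * ρ + 1])) (1 / ρ) ρ
      (10 * ρ) := by
  have hcost : ∀ a b c d, fcost3 a (F ![a, b, c, d]) + fcost3 b (F ![a, b, c, d]) +
      fcost3 c (F ![a, b, c, d]) + fcost3 d (F ![a, b, c, d]) ≤ ρ * optCost3 ![a, b, c, d] := by
    intro a b c d
    have := happrox ![a, b, c, d]
    simpa [scost3, Fin.sum_univ_four] using this
  have hmem : ∀ z x, fcost3 z (F x) ≤ 0 → z ∈ Set.range (F x) := by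
    intro z x h0
    obtain ⟨l, hl⟩ := exists_fcost3_eq z (F x)
    refine ⟨l, ?_⟩
    have := abs_nonpos_iff.1 (hl.trans_le h0)
    linarith
  have hsymm : ∀ a b c d, F ![a, b, c, d] = F ![b, a, c, d] := by
    intro a b c d
    rw [← hanon ![a, b, c, d] (Equiv.swap 0 1)]
    congr 1
    ext i
    fin_cases i <;> simp [Equiv.swap_apply_def]
  have hsp0 : ∀ a b c d y, fcost3 a (F ![a, b, c, d]) ≤ fcost3 a (F ![y, b, c, d]) := by
    intro a b c d y
    have hupd : Function.update ![a, b, c, d] 0 y = ![y, b, c, d] := by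
      ext i
      fin_cases i <;> simp [Function.update]
    have := hsp ![a, b, c, d] 0 y
    rwa [hupd] at this
  set c := 100 * ρ with hc
  set d := 100 * ρ + 1 with hd
  refine ⟨fun a b => by simp only [hsymm a b], ?_, ?_, ?_, ?_, ?_⟩
  · rintro a b z ⟨l, hl⟩
    refine hmem _ _ ((hsp0 z b c d a).trans ((fcost3_le _ _ l).trans ?_))
    simp [hl]
  · rintro a y ⟨l, hl⟩ b
    obtain ⟨m, hm⟩ := exists_fcost3_eq b (F ![a, b, c, d])
    refine ⟨_, ⟨m, rfl⟩, ?_⟩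
    rw [abs_sub_comm, hm, ← hl, abs_sub_comm _ b, hsymm a b, hsymm a y]
    exact (hsp0 b a c d y).trans (fcost3_le _ _ l)
  · rintro a b ha hb hab _ ⟨i, rfl⟩ _ ⟨j, rfl⟩ hi hj
    have hsum := (hcost a b c d).trans
      (mul_le_mul_of_nonneg_left (optCost3_le_left a b c d) (by linarith))
    rw [lt_div_iff₀ (by linarith)] at hab
    have ha0 := fcost3_nonneg a (F ![a, b, c, d])
    have hb0 := fcost3_nonneg b (F ![a, b, c, d])
    obtain ⟨k, hk⟩ := exists_fcost3_eq c (F ![a, b, c, d])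
    obtain ⟨l, hl⟩ := exists_fcost3_eq d (F ![a, b, c, d])
    generalize F ![a, b, c, d] = y at *
    have hkl1 : |c - y k| + |d - y l| < 1 := by linarith
    have hk' := abs_le.1 (le_refl |c - y k|)
    have hl' := abs_le.1 (le_refl |d - y l|)
    have hk0 := abs_nonneg (c - y k)
    have hl0 := abs_nonneg (d - y l)
    rw [abs_le] at hi hj
    have hkl : k ≠ l := by rintro rfl; linarith
    have hik : i ≠ k := by rintro rfl; linarith
    have hil : i ≠ l := by rintro rfl; linarith
    have hjk : j ≠ k := by rintro rfl; linarith
    have hjl : j ≠ l := by rintro rfl; linarith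
    have : i = j := by omega
    rw [this]
  · intro a
    refine hmem _ _ ?_
    have h1 := hcost a a c d
    have h2 := mul_le_mul_of_nonneg_left (optCost3_le_left a a c d) (by linarith : 0 ≤ ρ)
    rw [sub_self, abs_zero, mul_zero] at h2
    have := fcost3_nonneg a (F ![a, a, c, d])
    have := fcost3_nonneg c (F ![a, a, c, d])
    have := fcost3_nonneg d (F ![a, a, c, d])
    linarith
  · intro a b _ _
    obtain ⟨l, hl⟩ := exists_fcost3_eq b (F ![a, b, c, d])
    refine ⟨_, ⟨l, rfl⟩, ?_⟩
    rw [abs_sub_comm, hl]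
    have h1 := hcost a b c d
    have h2 := mul_le_mul_of_nonneg_left (optCost3_le_right a b c d) (by linarith : 0 ≤ ρ)
    have hcd : |c - d| = 1 := by rw [hc, hd]; norm_num
    rw [hcd, mul_one] at h2
    have := fcost3_nonneg a (F ![a, b, c, d])
    have := fcost3_nonneg c (F ![a, b, c, d])
    have := fcost3_nonneg d (F ![a, b, c, d])
    linarith

/-- There is no deterministic anonymous strategyproof mechanism with bounded
approximation ratio for 3-Facility Location with 4 agents on the line:
for every `ρ ≥ 1` no mechanism mapping 4 reports to 3 (sorted) facilities is
anonymous, strategyproof, and `ρ`-approximate for the social cost. -/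
theorem no_anonymous_nice_three_facility (ρ : ℝ) (hρ : 1 ≤ ρ) :
    ¬ ∃ F : (Fin 4 → ℝ) → (Fin 3 → ℝ),
      (∀ x, Monotone (F x)) ∧
      (∀ (x : Fin 4 → ℝ) (π : Equiv.Perm (Fin 4)), F (x ∘ π) = F x) ∧
      (∀ (x : Fin 4 → ℝ) (i : Fin 4) (y : ℝ),
        fcost3 (x i) (F x) ≤ fcost3 (x i) (F (Function.update x i y))) ∧
      (∀ x : Fin 4 → ℝ, scost3 x (F x) ≤ ρ * optCost3 x) := by
  rintro ⟨F, -, hanon, hsp, happrox⟩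
  have hρ0 : 0 < ρ := by linarith
  refine (isPairMechanism_of_nice hρ hanon hsp happrox).false (by positivity) ?_ le_rfl
  rw [div_le_iff₀ hρ0]
  nlinarith
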